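/- arXiv:1211.4534 — 2 statements merged into one kernel-verified Lean document; each statement's English description precedes it below -/
import Mathlib

section
/- Let n ≥ 2, h > 0 and m > 0. Let φ_1,…,φ_n be real polynomials forming a basis of the space P_{n−1} of polynomials of degree at most n−1, with φ_1(0) = 1 and φ_i(0) = 0 for 2 ≤ i ≤ n, and suppose that the derivatives φ_1',…,φ_{n−1}' span P_{n−2}, the space of polynomials of degree at most n−2. Define the matrix A ∈ ℝ^{n×n} by A_{1,1} = 1, A_{1,i} = 0 for 2 ≤ i ≤ n, and A_{p+1,i} = ∫₀ʰ m φ_i'(t) φ_p'(t) dt for 1 ≤ p ≤ n−1 and 1 ≤ i ≤ n. Then A is invertible. -/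
open scoped BigOperators

/-- **Invertibility of the matrix `A` of the linear (kinetic) part of the internal stage
equations** of a Galerkin variational integrator for `L(q,q̇) = ½ m q̇² − V(q)`.
The basis functions `φ 0, …, φ (n-1)` form a basis of the polynomials of degree at most
`n - 1`, with `φ 0` the basis function attached to the initial node (`φ 0 (0) = 1`,
`φ i (0) = 0` otherwise), and the derivatives of the first `n - 1` basis functions span
the polynomials of degree at most `n - 2`. -/
theorem galerkin_kinetic_matrix_invertible
    (n : ℕ) (hn : 2 ≤ n) (h : ℝ) (hh : 0 < h) (m : ℝ) (hm : 0 < m)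
    (φ : Fin n → Polynomial ℝ)
    (hdeg : ∀ i, φ i ∈ Polynomial.degreeLE ℝ ((n - 1 : ℕ) : WithBot ℕ))
    (hind : LinearIndependent ℝ φ)
    (hspan : Submodule.span ℝ (Set.range φ) = Polynomial.degreeLE ℝ ((n - 1 : ℕ) : WithBot ℕ))
    (hval0 : (φ ⟨0, by omega⟩).eval 0 = 1)
    (hvali : ∀ i : Fin n, (i : ℕ) ≠ 0 → (φ i).eval 0 = 0)
    (hderivspan :
      Submodule.span ℝ
          (Set.range fun i : Fin (n - 1) =>
            Polynomial.derivative (φ (Fin.castLE (by omega) i))) =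
        Polynomial.degreeLE ℝ ((n - 2 : ℕ) : WithBot ℕ))
    (A : Matrix (Fin n) (Fin n) ℝ)
    (hA00 : A ⟨0, by omega⟩ ⟨0, by omega⟩ = 1)
    (hA0i : ∀ i : Fin n, (i : ℕ) ≠ 0 → A ⟨0, by omega⟩ i = 0)
    (hArow : ∀ r : Fin n, (r : ℕ) ≠ 0 → ∀ i : Fin n,
      A r i = ∫ t in (0 : ℝ)..h,
        m * (Polynomial.derivative (φ i)).eval t *
          (Polynomial.derivative (φ ⟨(r : ℕ) - 1, by have := r.isLt; omega⟩)).eval t) :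
    IsUnit A := by
  classical
  rw [← Matrix.mulVec_injective_iff_isUnit]
  rw [← Matrix.coe_mulVecLin, ← LinearMap.ker_eq_bot, LinearMap.ker_eq_bot']
  intro v hv
  rw [Matrix.mulVecLin_apply] at hv
  have hrow : ∀ r, ∑ i, A r i * v i = 0 := fun r => congrFun hv r
  have hv0 : v ⟨0, by omega⟩ = 0 := by
    have h1 := hrow ⟨0, by omega⟩
    rw [Finset.sum_eq_single (⟨0, by omega⟩ : Fin n)] at h1
    · rwa [hA00, one_mul] at h1
    · intro i _ hi
      rw [hA0i i (fun h0 => hi (Fin.ext h0)), zero_mul]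
    · simp
  obtain ⟨q, hq⟩ : ∃ q : Polynomial ℝ, q = ∑ i, v i • φ i := ⟨_, rfl⟩
  have hq0 : q.eval 0 = 0 := by
    rw [hq, Polynomial.eval_finsetSum]
    refine Finset.sum_eq_zero fun i _ => ?_
    by_cases hi : (i : ℕ) = 0
    · have : i = ⟨0, by omega⟩ := Fin.ext hi
      rw [this, hv0]; simp
    · simp [hvali i hi]
  have hqd : q ∈ Polynomial.degreeLE ℝ ((n - 1 : ℕ) : WithBot ℕ) := by
    rw [hq]
    exact Submodule.sum_mem _ fun i _ => Submodule.smul_mem _ _ (hdeg i)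
  have hdq : Polynomial.derivative q ∈ Polynomial.degreeLE ℝ ((n - 2 : ℕ) : WithBot ℕ) := by
    rw [Polynomial.mem_degreeLE, ← Polynomial.natDegree_le_iff_degree_le] at hqd ⊢
    have := Polynomial.natDegree_derivative_le q
    omega
  have key : ∀ f ∈ Submodule.span ℝ (Set.range fun i : Fin (n - 1) =>
            Polynomial.derivative (φ (Fin.castLE (by omega) i))),
      ∫ t in (0 : ℝ)..h, m * (Polynomial.derivative q).eval t * f.eval t = 0 := by
    intro f hf
    induction hf using Submodule.span_induction with
    | mem f hf =>
      obtain ⟨p, rfl⟩ := hf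
      have hp := p.isLt
      have h1 := hrow ⟨(p : ℕ) + 1, by omega⟩
      have h2 : ∀ i, A ⟨(p : ℕ) + 1, by omega⟩ i * v i = ∫ t in (0 : ℝ)..h,
          m * (Polynomial.derivative (φ i)).eval t *
          (Polynomial.derivative (φ (Fin.castLE (by omega) p))).eval t * v i := by
        intro i
        rw [hArow _ (by simp) i, intervalIntegral.integral_mul_const]
        rfl
      simp only [h2] at h1
      rw [← intervalIntegral.integral_finsetSum] at h1
      · rw [← h1]
        congr 1
        ext t
        simp only [hq, Polynomial.derivative_sum, Polynomial.eval_finsetSum,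
          Polynomial.derivative_smul, Polynomial.eval_smul, smul_eq_mul, Finset.mul_sum,
          Finset.sum_mul]
        exact Finset.sum_congr rfl fun i _ => by ring
      · intro i _
        exact Continuous.intervalIntegrable (by fun_prop) _ _
    | zero => simp
    | add f g _ _ hf hg =>
      simp only [Polynomial.eval_add, mul_add]
      rw [intervalIntegral.integral_add, hf, hg, add_zero] <;>
        exact Continuous.intervalIntegrable (by fun_prop) _ _
    | smul a f _ hf =>
      have : ∀ t, m * (Polynomial.derivative q).eval t * (a • f).eval t =
          a * (m * (Polynomial.derivative q).eval t * f.eval t) := by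
        intro t
        rw [Polynomial.eval_smul, smul_eq_mul]; ring
      simp only [this]
      rw [intervalIntegral.integral_const_mul, hf, mul_zero]
  have hzero_int := key _ (hderivspan ▸ hdq)
  have hdq0 : Polynomial.derivative q = 0 := by
    apply Polynomial.eq_zero_of_infinite_isRoot
    refine (Set.Icc_infinite hh).mono fun c hc => ?_
    by_contra hne
    refine (intervalIntegral.integral_pos hh (f := fun t =>
      m * (Polynomial.derivative q).eval t * (Polynomial.derivative q).eval t)
      (Continuous.continuousOn (by fun_prop)) ?_ ⟨c, hc, ?_⟩).ne' hzero_int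
    · intro x _
      rw [mul_assoc]
      exact mul_nonneg hm.le (mul_self_nonneg _)
    · rw [mul_assoc]
      exact mul_pos hm (mul_self_pos.mpr hne)
  have hqz : q = 0 := by
    have h1 := Polynomial.eq_C_of_derivative_eq_zero hdq0
    rw [Polynomial.coeff_zero_eq_eval_zero, hq0] at h1
    simpa using h1
  funext i
  exact Fintype.linearIndependent_iff.mp hind v (hq ▸ hqz) i
end

section
/- Let D ∈ ℕ, h > 0, s ∈ ℕ. Let M ∈ ℝ^{D×D} be symmetric positive-definite with xᵀMx ≥ m|x|² for all x ∈ ℝ^D, where m > 0. Let V : ℝ^D → ℝ be twice continuously differentiable with all second partial derivatives bounded: |∂²V/∂q_l∂q_m(x)| ≤ C_R for all x ∈ ℝ^D and all l, m. Let c_1,…,c_k ∈ [0,1] and b_1,…,b_k > 0 be a quadrature rule that is exact on polynomials of degree at most 2s, i.e., h·Σ_{j=1}^k b_j p(c_j h) = ∫₀ʰ p(t) dt for every polynomial p of degree ≤ 2s. For a curve q : [0,h] → ℝ^D whose components are polynomials of degree at most s, define the discrete action S_d(q) = h·Σ_{j=1}^k b_j ( ½ q'(c_j h)ᵀ M q'(c_j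 h) − V(q(c_j h)) ). Suppose q is a stationary point of S_d, i.e., h·Σ_{j=1}^k b_j ( q'(c_j h)ᵀ M δq'(c_j h) − ∇V(q(c_j h))·δq(c_j h) ) = 0 for every curve δq with components polynomials of degree at most s and δq(0) = δq(h) = 0. If h < π·√(m/(D·C_R)), then for every such δq, S_d(q + δq) − S_d(q) ≥ ½ (m π²/h² − D C_R) ∫₀ʰ δq(t)ᵀ δq(t) dt; in particular S_d(q + δq) > S_d(q) whenever δq is not identically zero, so the stationary point q is a strict minimizer of the discrete action. -/
open scoped BigOperators Matrix

/-- Pointwise evaluation of a vector of polynomials, giving a polynomial curve in `ℝ^D`. -/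
noncomputable def polyEval {D : ℕ} (P : Fin D → Polynomial ℝ) (t : ℝ) : Fin D → ℝ :=
  fun i => (P i).eval t

/-- Pointwise evaluation of the derivative of a vector of polynomials. -/
noncomputable def polyDerivEval {D : ℕ} (P : Fin D → Polynomial ℝ) (t : ℝ) : Fin D → ℝ :=
  fun i => (Polynomial.derivative (P i)).eval t

/-- The discrete action of a Galerkin variational integrator for the Lagrangian
`L(q,q̇) = ½ q̇ᵀ M q̇ − V(q)`, obtained by applying the quadrature rule with nodes
`c j` and weights `b j` on `[0,h]` to the Lagrangian along the polynomial curve `P`. -/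
noncomputable def discreteAction {D k : ℕ} (h : ℝ) (c b : Fin k → ℝ)
    (M : Matrix (Fin D) (Fin D) ℝ) (V : (Fin D → ℝ) → ℝ)
    (P : Fin D → Polynomial ℝ) : ℝ :=
  h * ∑ j, b j *
    ((1 / 2) * (polyDerivEval P (c j * h) ⬝ᵥ (M *ᵥ polyDerivEval P (c j * h))) -
      V (polyEval P (c j * h)))

/-- Wirtinger's inequality with a constant below the sharp one. -/
lemma wirtinger_sub (h κ : ℝ) (hh : 0 < h) (hκ : 0 < κ) (hκh : κ * h < Real.pi)
    (p : Polynomial ℝ) (h0 : p.eval 0 = 0) (h1 : p.eval h = 0) :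
    0 ≤ ∫ t in (0 : ℝ)..h, ((p.derivative.eval t) ^ 2 - κ ^ 2 * (p.eval t) ^ 2) := by
  have hcos : ∀ t ∈ Set.Icc (0 : ℝ) h, Real.cos (κ * (t - h / 2)) ≠ 0 := by
    intro t ht
    apply ne_of_gt
    apply Real.cos_pos_of_mem_Ioo
    constructor <;> nlinarith [ht.1, ht.2]
  have hder : ∀ t ∈ Set.Icc (0 : ℝ) h, HasDerivAt
      (fun t => (-κ * Real.tan (κ * (t - h / 2))) * (p.eval t) ^ 2)
      ((-κ * (1 / Real.cos (κ * (t - h / 2)) ^ 2 * κ)) * (p.eval t) ^ 2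
        + (-κ * Real.tan (κ * (t - h / 2))) * (2 * p.eval t * p.derivative.eval t)) t := by
    intro t ht
    have e1 : HasDerivAt (fun t : ℝ => κ * (t - h / 2)) κ t := by
      simpa using ((hasDerivAt_id t).sub_const (h / 2)).const_mul κ
    have e2 := ((Real.hasDerivAt_tan (hcos t ht)).comp t e1).const_mul (-κ)
    have e3 := (p.hasDerivAt t).pow 2
    have e4 := e2.mul e3
    refine e4.congr_deriv ?_
    simp
  have key := intervalIntegral.sub_le_integral_of_hasDeriv_right_of_le (a := 0) (b := h)
    (g := fun t => (-κ * Real.tan (κ * (t - h / 2))) * (p.eval t) ^ 2)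
    (φ := fun t => (p.derivative.eval t) ^ 2 - κ ^ 2 * (p.eval t) ^ 2) hh.le
    (fun t ht => (hder t ht).continuousAt.continuousWithinAt)
    (fun t ht => (hder t (Set.Ioo_subset_Icc_self ht)).hasDerivWithinAt)
    (by
      apply Continuous.integrableOn_Icc
      exact (p.derivative.continuous.pow 2).sub (continuous_const.mul (p.continuous.pow 2)))
    (by
      intro t ht
      have hc := hcos t (Set.Ioo_subset_Icc_self ht)
      have e : 1 / Real.cos (κ * (t - h / 2)) ^ 2 = 1 + Real.tan (κ * (t - h / 2)) ^ 2 := by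
        rw [one_div, ← Real.inv_one_add_tan_sq hc, inv_inv]
      rw [e]
      nlinarith [sq_nonneg (p.derivative.eval t + κ * Real.tan (κ * (t - h / 2)) * p.eval t)])
  simpa [h0, h1] using key

lemma wirtinger (h : ℝ) (hh : 0 < h)
    (p : Polynomial ℝ) (h0 : p.eval 0 = 0) (h1 : p.eval h = 0) :
    Real.pi ^ 2 / h ^ 2 * ∫ t in (0 : ℝ)..h, (p.eval t) ^ 2 ≤
      ∫ t in (0 : ℝ)..h, (p.derivative.eval t) ^ 2 := by
  have hk : ∀ κ ∈ Set.Ioo (0 : ℝ) (Real.pi / h), κ ^ 2 * ∫ t in (0 : ℝ)..h, (p.eval t) ^ 2 ≤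
      ∫ t in (0 : ℝ)..h, (p.derivative.eval t) ^ 2 := by
    intro κ hκ
    have := wirtinger_sub h κ hh hκ.1 ((lt_div_iff₀ hh).1 hκ.2) p h0 h1
    rw [intervalIntegral.integral_sub, intervalIntegral.integral_const_mul] at this
    · linarith
    · exact (p.derivative.continuous.pow 2).intervalIntegrable _ _
    · exact (continuous_const.mul (p.continuous.pow 2)).intervalIntegrable _ _
  have hpos : 0 < Real.pi / h := div_pos Real.pi_pos hh
  rw [← div_pow]
  have hcl : Real.pi / h ∈ closure (Set.Ioo (0 : ℝ) (Real.pi / h)) := by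
    rw [closure_Ioo hpos.ne]
    exact ⟨hpos.le, le_rfl⟩
  exact closure_minimal (t := {κ : ℝ | κ ^ 2 * ∫ t in (0 : ℝ)..h, (p.eval t) ^ 2 ≤
      ∫ t in (0 : ℝ)..h, (p.derivative.eval t) ^ 2}) hk
    (isClosed_le (by fun_prop) (by fun_prop)) hcl

/-- Second-order Taylor upper bound in one variable. -/
lemma taylor_one (f f' f'' : ℝ → ℝ) (K : ℝ) (hf : ∀ t, HasDerivAt f (f' t) t)
    (hf' : ∀ t, HasDerivAt f' (f'' t) t) (hK : ∀ t, f'' t ≤ K) :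
    f 1 - f 0 - f' 0 ≤ K / 2 := by
  have d1 : ∀ t, HasDerivAt (fun t => f' t - K * t) (f'' t - K) t := by
    intro t
    refine ((hf' t).sub ((hasDerivAt_id t).const_mul K)).congr_deriv ?_
    simp
  have a1 : Antitone (fun t => f' t - K * t) :=
    antitone_of_hasDerivAt_nonpos d1 (fun t => by simpa using hK t)
  have d2 : ∀ t, HasDerivAt (fun t => f t - f' 0 * t - K / 2 * t ^ 2)
      (f' t - f' 0 - K * t) t := by
    intro t
    have := ((hf t).sub ((hasDerivAt_id t).const_mul (f' 0))).sub
      (((hasDerivAt_id t).pow 2).const_mul (K / 2))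
    refine this.congr_deriv ?_
    simp
    ring
  have a2 : AntitoneOn (fun t => f t - f' 0 * t - K / 2 * t ^ 2) (Set.Icc 0 1) := by
    apply antitoneOn_of_deriv_nonpos (convex_Icc 0 1)
    · exact fun t _ => (d2 t).continuousAt.continuousWithinAt
    · exact fun t _ => (d2 t).differentiableAt.differentiableWithinAt
    · intro t ht
      rw [(d2 t).deriv]
      rw [interior_Icc] at ht
      have := a1 ht.1.le
      simp at this
      linarith
  have := a2 (Set.left_mem_Icc.2 zero_le_one) (Set.right_mem_Icc.2 zero_le_one) zero_le_one
  simp at this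
  linarith

lemma clm_expand {D : ℕ} (L : (Fin D → ℝ) →L[ℝ] ℝ) (v : Fin D → ℝ) :
    L v = ∑ l, v l * L (Pi.single l 1) := by
  conv_lhs => rw [pi_eq_sum_univ' v]
  simp only [map_sum, map_smul, smul_eq_mul]

lemma taylor_V {D : ℕ} (V : (Fin D → ℝ) → ℝ) (hV : ContDiff ℝ 2 V) (CR : ℝ)
    (hVbound : ∀ x : Fin D → ℝ, ∀ l m' : Fin D,
      |fderiv ℝ (fun y => fderiv ℝ V y (Pi.single l 1)) x (Pi.single m' 1)| ≤ CR)
    (x v : Fin D → ℝ) :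
    V (x + v) - V x - fderiv ℝ V x v ≤ D * CR * (v ⬝ᵥ v) / 2 := by
  have dV : Differentiable ℝ V := hV.differentiable (by norm_num)
  have dg : ∀ l, Differentiable ℝ (fun y => fderiv ℝ V y (Pi.single l 1)) := by
    intro l
    have : ContDiff ℝ 1 (fderiv ℝ V) := hV.fderiv_right (by norm_num)
    exact (this.differentiable (by norm_num)).clm_apply (differentiable_const _)
  have dl : ∀ t : ℝ, HasDerivAt (fun t : ℝ => x + t • v) v t := by
    intro t
    simpa using ((hasDerivAt_id t).smul_const v).const_add x
  have := taylor_one (fun t => V (x + t • v)) (fun t => fderiv ℝ V (x + t • v) v)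
    (fun t => ∑ l, v l * fderiv ℝ (fun y => fderiv ℝ V y (Pi.single l 1)) (x + t • v) v)
    (D * CR * (v ⬝ᵥ v))
    (fun t => (dV _).hasFDerivAt.comp_hasDerivAt t (dl t))
    (by
      intro t
      have e : (fun t : ℝ => fderiv ℝ V (x + t • v) v) =
          fun t : ℝ => ∑ l, v l * fderiv ℝ V (x + t • v) (Pi.single l 1) := by
        funext t
        exact clm_expand _ _
      rw [e]
      refine HasDerivAt.fun_sum fun l _ => HasDerivAt.const_mul _ ?_
      exact ((dg l) _).hasFDerivAt.comp_hasDerivAt t (dl t))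
    (by
      intro t
      have h1 : ∑ l, v l * fderiv ℝ (fun y => fderiv ℝ V y (Pi.single l 1)) (x + t • v) v
          ≤ ∑ l : Fin D, ∑ m' : Fin D, CR * ((v l ^ 2 + v m' ^ 2) / 2) := by
        refine Finset.sum_le_sum fun l _ => ?_
        rw [clm_expand, Finset.mul_sum]
        refine Finset.sum_le_sum fun m' _ => ?_
        have hb := hVbound (x + t • v) l m'
        set a := fderiv ℝ (fun y => fderiv ℝ V y (Pi.single l 1)) (x + t • v) (Pi.single m' 1)
        have hb' := abs_le.1 hb
        nlinarith [mul_nonneg (sub_nonneg.2 hb'.2) (sq_nonneg (v l + v m')),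
          mul_nonneg (by linarith : 0 ≤ CR + a) (sq_nonneg (v l - v m'))]
      refine h1.trans (le_of_eq ?_)
      simp only [← Finset.mul_sum, ← Finset.sum_div, Finset.sum_add_distrib, Finset.sum_const,
        Finset.card_univ, Fintype.card_fin, nsmul_eq_mul, dotProduct, ← pow_two]
      ring)
  simpa using this

/-- **Stationary points of the discrete action are strict minimizers** for Lagrangians
`L(q,q̇) = ½ q̇ᵀ M q̇ − V(q)` with `M` symmetric positive-definite and `V` having bounded
second derivatives, provided the quadrature rule is exact on polynomials of degree
`≤ 2s` and `h < π √(m/(D·C_R))`. -/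
theorem discrete_action_stationary_point_is_minimizer
    (D : ℕ) (h : ℝ) (hh : 0 < h) (s : ℕ)
    (M : Matrix (Fin D) (Fin D) ℝ) (hMsymm : M.IsSymm)
    (m : ℝ) (hm : 0 < m)
    (hMpos : ∀ x : Fin D → ℝ, m * (x ⬝ᵥ x) ≤ x ⬝ᵥ (M *ᵥ x))
    (V : (Fin D → ℝ) → ℝ) (hV : ContDiff ℝ 2 V) (CR : ℝ)
    (hVbound : ∀ x : Fin D → ℝ, ∀ l m' : Fin D,
      |fderiv ℝ (fun y => fderiv ℝ V y (Pi.single l 1)) x (Pi.single m' 1)| ≤ CR)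
    (k : ℕ) (c : Fin k → ℝ) (hc : ∀ j, c j ∈ Set.Icc (0 : ℝ) 1)
    (b : Fin k → ℝ) (hb : ∀ j, 0 < b j)
    (hquad : ∀ p : Polynomial ℝ, p.degree ≤ ((2 * s : ℕ) : WithBot ℕ) →
      h * ∑ j, b j * p.eval (c j * h) = ∫ t in (0 : ℝ)..h, p.eval t)
    (P : Fin D → Polynomial ℝ) (hP : ∀ i, (P i).degree ≤ ((s : ℕ) : WithBot ℕ))
    (hstat : ∀ Q : Fin D → Polynomial ℝ, (∀ i, (Q i).degree ≤ ((s : ℕ) : WithBot ℕ)) →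
      polyEval Q 0 = 0 → polyEval Q h = 0 →
      h * ∑ j, b j *
        (polyDerivEval P (c j * h) ⬝ᵥ (M *ᵥ polyDerivEval Q (c j * h)) -
          fderiv ℝ V (polyEval P (c j * h)) (polyEval Q (c j * h))) = 0)
    (hsmall : h < Real.pi * Real.sqrt (m / (D * CR))) :
    ∀ Q : Fin D → Polynomial ℝ, (∀ i, (Q i).degree ≤ ((s : ℕ) : WithBot ℕ)) →
      polyEval Q 0 = 0 → polyEval Q h = 0 →
      ((1 / 2) * (m * Real.pi ^ 2 / h ^ 2 - D * CR) *
          ∫ t in (0 : ℝ)..h, polyEval Q t ⬝ᵥ polyEval Q t) ≤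
        discreteAction h c b M V (fun i => P i + Q i) - discreteAction h c b M V P ∧
      ((∃ i, Q i ≠ 0) →
        discreteAction h c b M V P < discreteAction h c b M V (fun i => P i + Q i)) := by
  intro Q hQ hQ0 hQh
  have hD : 0 < (D : ℝ) * CR := by
    by_contra hcon
    have : Real.sqrt (m / (D * CR)) = 0 :=
      Real.sqrt_eq_zero_of_nonpos (div_nonpos_of_nonneg_of_nonpos hm.le (not_lt.1 hcon))
    rw [this] at hsmall
    linarith
  have hcoef : 0 < m * Real.pi ^ 2 / h ^ 2 - D * CR := by
    have h2 : h ^ 2 < Real.pi ^ 2 * (m / (D * CR)) := by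
      have := pow_lt_pow_left₀ hsmall hh.le (two_ne_zero)
      rwa [mul_pow, Real.sq_sqrt (div_pos hm hD).le] at this
    have h3 : D * CR * h ^ 2 < m * Real.pi ^ 2 := by
      rw [← mul_div_assoc, lt_div_iff₀ hD] at h2
      linarith
    have : D * CR < m * Real.pi ^ 2 / h ^ 2 := by
      rwa [lt_div_iff₀ (by positivity)]
    linarith
  have hq0 : ∀ i, (Q i).eval 0 = 0 := fun i => congrFun hQ0 i
  have hqh : ∀ i, (Q i).eval h = 0 := fun i => congrFun hQh i
  -- the difference of actions, bounded pointwise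
  have hdiff : h * ∑ j, b j * ((1 / 2) * (m * (polyDerivEval Q (c j * h) ⬝ᵥ
        polyDerivEval Q (c j * h)) - D * CR * (polyEval Q (c j * h) ⬝ᵥ polyEval Q (c j * h))))
      ≤ discreteAction h c b M V (fun i => P i + Q i) - discreteAction h c b M V P := by
    have hs := hstat Q hQ hQ0 hQh
    rw [← sub_zero (discreteAction h c b M V (fun i => P i + Q i) - _), ← hs]
    unfold discreteAction
    rw [← mul_sub, ← mul_sub, ← Finset.sum_sub_distrib, ← Finset.sum_sub_distrib]
    refine mul_le_mul_of_nonneg_left (Finset.sum_le_sum fun j _ => ?_) hh.le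
    rw [← mul_sub, ← mul_sub]
    refine mul_le_mul_of_nonneg_left ?_ (hb j).le
    have e1 : polyEval (fun i => P i + Q i) (c j * h) =
        polyEval P (c j * h) + polyEval Q (c j * h) := by
      ext i; simp [polyEval]
    have e2 : polyDerivEval (fun i => P i + Q i) (c j * h) =
        polyDerivEval P (c j * h) + polyDerivEval Q (c j * h) := by
      ext i; simp [polyDerivEval]
    rw [e1, e2]
    have hT := taylor_V V hV CR hVbound (polyEval P (c j * h)) (polyEval Q (c j * h))
    have hM := hMpos (polyDerivEval Q (c j * h))
    generalize polyDerivEval P (c j * h) = p at *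
    generalize polyDerivEval Q (c j * h) = q at *
    have hsym : q ⬝ᵥ (M *ᵥ p) = p ⬝ᵥ (M *ᵥ q) := by
      rw [Matrix.dotProduct_mulVec, ← Matrix.mulVec_transpose, hMsymm.eq, dotProduct_comm]
    rw [Matrix.mulVec_add, dotProduct_add, add_dotProduct, add_dotProduct, hsym]
    linarith
  -- exactness of the quadrature
  have hexact : h * ∑ j, b j * ((1 / 2) * (m * (polyDerivEval Q (c j * h) ⬝ᵥ
        polyDerivEval Q (c j * h)) - D * CR * (polyEval Q (c j * h) ⬝ᵥ polyEval Q (c j * h))))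
      = ∑ i, (1 / 2) * (m * (∫ t in (0 : ℝ)..h, ((Q i).derivative.eval t) ^ 2)
          - D * CR * ∫ t in (0 : ℝ)..h, ((Q i).eval t) ^ 2) := by
    have hnat : ∀ i, (Q i).natDegree ≤ s := fun i => Polynomial.natDegree_le_of_degree_le (hQ i)
    have hA : ∀ i, h * ∑ j, b j * ((Q i).eval (c j * h)) ^ 2 =
        ∫ t in (0 : ℝ)..h, ((Q i).eval t) ^ 2 := by
      intro i
      have := hquad ((Q i) ^ 2) (Polynomial.degree_le_of_natDegree_le
        (Polynomial.natDegree_pow_le_of_le 2 (hnat i)))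
      simpa using this
    have hB : ∀ i, h * ∑ j, b j * ((Q i).derivative.eval (c j * h)) ^ 2 =
        ∫ t in (0 : ℝ)..h, ((Q i).derivative.eval t) ^ 2 := by
      intro i
      have := hquad ((Q i).derivative ^ 2) (Polynomial.degree_le_of_natDegree_le
        (Polynomial.natDegree_pow_le_of_le 2
          ((Polynomial.natDegree_derivative_le _).trans ((Nat.sub_le _ _).trans (hnat i)))))
      simpa using this
    simp only [← hA, ← hB, polyEval, polyDerivEval, dotProduct, Finset.mul_sum,
      ← Finset.sum_sub_distrib]
    rw [Finset.sum_comm]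
    refine Finset.sum_congr rfl fun i _ => Finset.sum_congr rfl fun j _ => ?_
    ring
  have hint : ∫ t in (0 : ℝ)..h, polyEval Q t ⬝ᵥ polyEval Q t =
      ∑ i, ∫ t in (0 : ℝ)..h, ((Q i).eval t) ^ 2 := by
    simp only [polyEval, dotProduct, ← pow_two]
    exact intervalIntegral.integral_finset_sum fun i _ =>
      ((Q i).continuous.pow 2).intervalIntegrable _ _
  have hmain : (1 / 2) * (m * Real.pi ^ 2 / h ^ 2 - D * CR) *
          (∫ t in (0 : ℝ)..h, polyEval Q t ⬝ᵥ polyEval Q t) ≤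
        discreteAction h c b M V (fun i => P i + Q i) - discreteAction h c b M V P := by
    refine le_trans ?_ hdiff
    rw [hexact, hint, Finset.mul_sum]
    refine Finset.sum_le_sum fun i _ => ?_
    have hw := mul_le_mul_of_nonneg_left (wirtinger h hh (Q i) (hq0 i) (hqh i)) hm.le
    rw [mul_div_assoc]
    linarith
  refine ⟨hmain, ?_⟩
  rintro ⟨i, hi⟩
  have hpos : 0 < ∫ t in (0 : ℝ)..h, polyEval Q t ⬝ᵥ polyEval Q t := by
    rw [hint]
    refine Finset.sum_pos' (fun i _ => intervalIntegral.integral_nonneg hh.le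
      fun t _ => sq_nonneg _) ⟨i, Finset.mem_univ i, ?_⟩
    obtain ⟨t, ht, hne⟩ : ∃ t ∈ Set.Icc (0 : ℝ) h, (Q i).eval t ≠ 0 := by
      by_contra! hcon
      exact hi (Polynomial.eq_zero_of_infinite_isRoot _
        ((Set.Icc_infinite hh).mono fun t ht => hcon t ht))
    exact intervalIntegral.integral_pos hh ((Q i).continuous.pow 2).continuousOn
      (fun t _ => sq_nonneg _) ⟨t, ht, by positivity⟩
  have : 0 < (1 / 2) * (m * Real.pi ^ 2 / h ^ 2 - D * CR) *
          (∫ t in (0 : ℝ)..h, polyEval Q t ⬝ᵥ polyEval Q t) := by positivity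
  linarith
end
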